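/- arXiv:2409.15880 — 7 statements merged into one kernel-verified Lean document; each statement's English description precedes it below -/
import Mathlib

section
/- Let G be a countable group acting on W by negligibility-preserving homeomorphisms and let 𝒦 be a finite set of tiles that yields a grid. Then (i) the map T ↦ grp_𝒦(T) is a bijection from the set of ≡_λ-classes of poly-𝒦 tiles in W onto the set of nonempty finite subsets of G×𝒦, and (ii) for every finite set 𝒯 of poly-𝒦 tiles, a countable set C ⊆ G×𝒯 is a cotiler of 𝒯 in W if and only if {(g, grp_𝒦(T)) : (g,T) ∈ C} is a cotiler of the tileset {grp_𝒦(T) : T ∈ 𝒯} in the countable set G×𝒦 equipped with the counting measure, where G acts on G×𝒦 by g·(h,K) = (gh,K). -/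
open scoped Pointwise
open MeasureTheory

variable {W : Type*} [TopologicalSpace W] [MeasurableSpace W] [BorelSpace W]
variable {G : Type*} [Group G] [MulAction G W]

/-- `C ⊆ G × 𝒯` is a cotiler: a countable family whose translated tiles are pairwise
disjoint up to `μ`-null sets and cover `W` up to a `μ`-null set. -/
def IsCotiler (μ : Measure W) (C : Set (G × Set W)) : Prop :=
  C.Countable ∧
  (∀ p ∈ C, ∀ q ∈ C, p ≠ q → μ (p.1 • p.2 ∩ q.1 • q.2) = 0) ∧
  μ ((⋃ p ∈ C, p.1 • p.2)ᶜ) = 0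

/-- `D ⊆ G × 𝒦` witnesses that `T` is a poly-`𝒦` tile, i.e. `D = grp_𝒦(T)`. -/
def IsPolyDecomp (μ : Measure W) (𝒦 : Set (Set W)) (T : Set W) (D : Set (G × Set W)) : Prop :=
  D.Finite ∧ D ⊆ (Set.univ : Set G) ×ˢ 𝒦 ∧ μ (symmDiff T (⋃ p ∈ D, p.1 • p.2)) = 0

/-- The action of `G` on `G × 𝒦` given by `g • (h, K) = (g * h, K)`, applied to a subset. -/
def prodSmul (g : G) (D : Set (G × Set W)) : Set (G × Set W) :=
  (fun p => (g * p.1, p.2)) '' D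

/-- The union of the translated tiles indexed by `D`. -/
def tileUnion {X H : Type*} [Group H] [MulAction H X] (D : Set (H × Set X)) : Set X :=
  ⋃ p ∈ D, p.1 • p.2

section TileUnion

variable {X H : Type*} [Group H] [MulAction H X]

theorem smul_tileUnion (g : H) (D : Set (H × Set X)) :
    g • tileUnion D = tileUnion (prodSmul g D) := by
  simp only [tileUnion, prodSmul, Set.smul_set_iUnion, Set.biUnion_image, mul_smul]

theorem tileUnion_biUnion {ι : Type*} (C : Set ι) (S : ι → Set (H × Set X)) :
    tileUnion (⋃ i ∈ C, S i) = ⋃ i ∈ C, tileUnion (S i) := by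
  simp only [tileUnion, Set.biUnion_iUnion]

theorem smul_subset_tileUnion {D : Set (H × Set X)} {p : H × Set X} (hp : p ∈ D) :
    p.1 • p.2 ⊆ tileUnion D :=
  Set.subset_biUnion_of_mem (u := fun p : H × Set X => p.1 • p.2) hp

variable [MeasurableSpace X] {ν : Measure X}

theorem measure_smul_eq_zero_iff_of_pos (hneg : ∀ (g : H) (A : Set X), 0 < ν A → 0 < ν (g • A))
    (g : H) (A : Set X) : ν (g • A) = 0 ↔ ν A = 0 := by
  refine ⟨fun h => ?_, fun h => ?_⟩
  · by_contra hA
    exact (hneg g A (pos_iff_ne_zero.2 hA)).ne' h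
  · by_contra hA
    have := hneg g⁻¹ _ (pos_iff_ne_zero.2 hA)
    rw [inv_smul_smul] at this
    exact this.ne' h

theorem smul_ae_eq_smul (hneg : ∀ (g : H) (A : Set X), 0 < ν A → 0 < ν (g • A))
    (g : H) {A B : Set X} (h : A =ᵐ[ν] B) : (g • A : Set X) =ᵐ[ν] (g • B : Set X) := by
  rw [← measure_symmDiff_eq_zero_iff] at h ⊢
  rwa [← Set.smul_set_symmDiff, measure_smul_eq_zero_iff_of_pos hneg]

variable {P S S' : Set (H × Set X)}

theorem measure_smul_inter_tileUnion_eq_zero (hP : P.Countable)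
    (hdisj : ∀ p ∈ P, ∀ q ∈ P, p ≠ q → ν (p.1 • p.2 ∩ q.1 • q.2) = 0)
    (hS : S ⊆ P) {p : H × Set X} (hp : p ∈ P) (hpS : p ∉ S) :
    ν (p.1 • p.2 ∩ tileUnion S) = 0 := by
  rw [tileUnion, Set.inter_iUnion₂, measure_biUnion_null_iff (hP.mono hS)]
  exact fun q hq => hdisj p hp q (hS hq) fun h => hpS (h ▸ hq)

theorem subset_of_tileUnion_ae_le (hP : P.Countable)
    (hdisj : ∀ p ∈ P, ∀ q ∈ P, p ≠ q → ν (p.1 • p.2 ∩ q.1 • q.2) = 0)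
    (hpos : ∀ p ∈ P, 0 < ν (p.1 • p.2))
    (hS : S ⊆ P) (hS' : S' ⊆ P) (h : tileUnion S ≤ᵐ[ν] tileUnion S') : S ⊆ S' := by
  intro p hp
  by_contra hpS'
  have h0 := measure_smul_inter_tileUnion_eq_zero hP hdisj hS' (hS hp) hpS'
  refine (hpos p (hS hp)).ne' (measure_mono_null_ae ?_ h0)
  filter_upwards [h] with x hx hxp
  exact ⟨hxp, hx (smul_subset_tileUnion hp hxp)⟩

theorem measure_tileUnion_inter_eq_zero_iff (hP : P.Countable)
    (hdisj : ∀ p ∈ P, ∀ q ∈ P, p ≠ q → ν (p.1 • p.2 ∩ q.1 • q.2) = 0)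
    (hpos : ∀ p ∈ P, 0 < ν (p.1 • p.2)) (hS : S ⊆ P) (hS' : S' ⊆ P) :
    ν (tileUnion S ∩ tileUnion S') = 0 ↔ Disjoint S S' := by
  refine ⟨fun h => Set.disjoint_left.2 fun p hp hp' => ?_, fun h => ?_⟩
  · exact (hpos p (hS hp)).ne' (measure_mono_null
      (Set.subset_inter (smul_subset_tileUnion hp) (smul_subset_tileUnion hp')) h)
  · rw [tileUnion.eq_def S, Set.iUnion₂_inter, measure_biUnion_null_iff (hP.mono hS)]
    exact fun p hp => measure_smul_inter_tileUnion_eq_zero hP hdisj hS' (hS hp)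
      (Set.disjoint_left.1 h hp)

theorem measure_compl_tileUnion_eq_zero_iff (hP : P.Countable)
    (hdisj : ∀ p ∈ P, ∀ q ∈ P, p ≠ q → ν (p.1 • p.2 ∩ q.1 • q.2) = 0)
    (hpos : ∀ p ∈ P, 0 < ν (p.1 • p.2)) (hcover : ν (tileUnion P)ᶜ = 0) (hS : S ⊆ P) :
    ν (tileUnion S)ᶜ = 0 ↔ S = P := by
  refine ⟨fun h => hS.antisymm ?_, fun h => h ▸ hcover⟩
  refine subset_of_tileUnion_ae_le hP hdisj hpos subset_rfl hS ?_
  filter_upwards [compl_mem_ae_iff.2 h] with x hx _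
  exact not_not.1 hx

end TileUnion

theorem prodSmul_subset_univ_prod {X H : Type*} [Group H] {𝒦 : Set (Set X)} {D : Set (H × Set X)}
    (g : H) (hD : D ⊆ Set.univ ×ˢ 𝒦) : prodSmul g D ⊆ Set.univ ×ˢ 𝒦 := by
  rintro _ ⟨p, hp, rfl⟩
  exact ⟨Set.mem_univ _, (hD hp).2⟩

theorem statement_0
    (hcont : ∀ g : G, Continuous fun x : W => g • x)
    (μ : Measure W) (hμ : μ ≠ 0) [Countable G]
    (hneg : ∀ (g : G) (A : Set W), 0 < μ A → 0 < μ (g • A))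
    (𝒦 : Set (Set W)) (h𝒦fin : 𝒦.Finite)
    (h𝒦tile : ∀ K ∈ 𝒦, MeasurableSet K ∧ 0 < μ K)
    (hgrid : IsCotiler μ ((Set.univ : Set G) ×ˢ 𝒦)) :
    -- (i) `T ↦ grp_𝒦(T)` is a well-defined bijection from `≡_λ`-classes of
    -- (positive measure) poly-`𝒦` tiles onto nonempty finite subsets of `G × 𝒦`:
    ((∀ (T : Set W) (D D' : Set (G × Set W)),
        IsPolyDecomp μ 𝒦 T D → IsPolyDecomp μ 𝒦 T D' → D = D') ∧
      (∀ (T T' : Set W) (D : Set (G × Set W)),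
        IsPolyDecomp μ 𝒦 T D → IsPolyDecomp μ 𝒦 T' D → μ (symmDiff T T') = 0) ∧
      (∀ (T : Set W) (D : Set (G × Set W)),
        0 < μ T → IsPolyDecomp μ 𝒦 T D → D.Nonempty) ∧
      (∀ D : Set (G × Set W), D.Finite → D ⊆ (Set.univ : Set G) ×ˢ 𝒦 → D.Nonempty →
        ∃ T : Set W, 0 < μ T ∧ IsPolyDecomp μ 𝒦 T D)) ∧
    -- (ii) for every finite set `𝒯` of poly-`𝒦` tiles, `C ⊆ G × 𝒯` is a cotiler of `𝒯`
    -- in `W` iff the renamed family is a cotiler of `{grp_𝒦(T) : T ∈ 𝒯}` in `G × 𝒦`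
    -- with the counting measure (i.e. a genuine partition of `G × 𝒦`):
    (∀ 𝒯 : Set (Set W), 𝒯.Finite → (∀ T ∈ 𝒯, MeasurableSet T ∧ 0 < μ T) →
      ∀ grpK : Set W → Set (G × Set W), (∀ T ∈ 𝒯, IsPolyDecomp μ 𝒦 T (grpK T)) →
      ∀ C : Set (G × Set W), C ⊆ (Set.univ : Set G) ×ˢ 𝒯 → C.Countable →
        (IsCotiler μ C ↔
          ((∀ p ∈ C, ∀ q ∈ C, p ≠ q →
              Disjoint (prodSmul p.1 (grpK p.2)) (prodSmul q.1 (grpK q.2))) ∧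
            (⋃ p ∈ C, prodSmul p.1 (grpK p.2)) = (Set.univ : Set G) ×ˢ 𝒦))) := by
  obtain ⟨hP, hdisj, hcover⟩ := hgrid
  have hpos : ∀ p ∈ (Set.univ : Set G) ×ˢ 𝒦, 0 < μ (p.1 • p.2) :=
    fun p hp => hneg _ _ (h𝒦tile _ hp.2).2
  have hae {T : Set W} {D : Set (G × Set W)} (h : IsPolyDecomp μ 𝒦 T D) :
      T =ᵐ[μ] tileUnion D := measure_symmDiff_eq_zero_iff.1 h.2.2
  refine ⟨⟨fun T D D' h h' => ?_, fun T T' D h h' => ?_, fun T D hT h => ?_,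
    fun D hfin hD hne => ?_⟩, ?_⟩
  · have heq := (hae h).symm.trans (hae h')
    exact (subset_of_tileUnion_ae_le hP hdisj hpos h.2.1 h'.2.1 heq.le).antisymm
      (subset_of_tileUnion_ae_le hP hdisj hpos h'.2.1 h.2.1 heq.symm.le)
  · exact measure_symmDiff_eq_zero_iff.2 ((hae h).trans (hae h').symm)
  · rw [Set.nonempty_iff_ne_empty]
    rintro rfl
    refine hT.ne' ?_
    rw [measure_congr (hae h)]
    simp [tileUnion]
  · obtain ⟨p, hp⟩ := hne
    refine ⟨tileUnion D, (hpos p (hD hp)).trans_le (measure_mono (smul_subset_tileUnion hp)),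
      hfin, hD, ?_⟩
    exact measure_symmDiff_eq_zero_iff.2 Filter.EventuallyEq.rfl
  · intro 𝒯 _ _ grpK hgrp C hC hCc
    have hsub : ∀ p ∈ C, prodSmul p.1 (grpK p.2) ⊆ (Set.univ : Set G) ×ˢ 𝒦 := fun p hp =>
      prodSmul_subset_univ_prod _ (hgrp _ (hC hp).2).2.1
    have htile : ∀ p ∈ C, (p.1 • p.2 : Set W) =ᵐ[μ] tileUnion (prodSmul p.1 (grpK p.2)) := by
      intro p hp
      rw [← smul_tileUnion]
      exact smul_ae_eq_smul hneg _ (hae (hgrp _ (hC hp).2))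
    have hunion : (⋃ p ∈ C, p.1 • p.2 : Set W) =ᵐ[μ]
        tileUnion (⋃ p ∈ C, prodSmul p.1 (grpK p.2)) := by
      rw [tileUnion_biUnion]
      exact Filter.EventuallyEq.countable_bUnion hCc htile
    rw [IsCotiler, and_iff_right hCc, measure_congr hunion.compl,
      measure_compl_tileUnion_eq_zero_iff hP hdisj hpos hcover (Set.iUnion₂_subset hsub)]
    refine and_congr_left' (forall₂_congr fun p hp => forall₂_congr fun q hq =>
      forall_congr' fun _ => ?_)
    rw [measure_congr ((htile p hp).inter (htile q hq)),
      measure_tileUnion_inter_eq_zero_iff hP hdisj hpos (hsub p hp) (hsub q hq)]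
end

section
/- Let G be a countable group acting on W by negligibility-preserving homeomorphisms and let K ⊆ W be a single tile such that {K} yields a grid (i.e. W = ⊔_{g∈G} g·K up to λ-null sets). Then the map T ↦ grp_K(T) is a bijection from the set of ≡_λ-classes of poly-K tiles onto the set of nonempty finite subsets of G, and for every poly-K tile T, a countable set C ⊆ G is a cotiler of T in W if and only if C is a cotiler of the finite subset grp_K(T) in the group G with counting measure, i.e. G = ⊔_{g∈C} g·grp_K(T). -/
open scoped Pointwise
open MeasureTheory

variable {W : Type*} [TopologicalSpace W] [MeasurableSpace W] [BorelSpace W]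
variable {G : Type*} [Group G] [MulAction G W]

/-- `C ⊆ G` is a cotiler of the single tile `T ⊆ W`: a countable set whose translates of `T`
are pairwise disjoint up to `μ`-null sets and cover `W` up to a `μ`-null set. -/
def IsCotilerOne (μ : Measure W) (T : Set W) (C : Set G) : Prop :=
  C.Countable ∧
  (∀ g ∈ C, ∀ h ∈ C, g ≠ h → μ ((g • T) ∩ (h • T)) = 0) ∧
  μ ((⋃ g ∈ C, g • T)ᶜ) = 0

/-- `D ⊆ G` witnesses that `T` is a poly-`K` tile, i.e. `D = grp_K(T)`:
`T ≡_λ ⋃_{h ∈ D} h • K`. -/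
def IsPolyKDecomp (μ : Measure W) (K T : Set W) (D : Set G) : Prop :=
  D.Finite ∧ μ (symmDiff T (⋃ h ∈ D, h • K)) = 0

section Grid

variable {X Γ : Type*} [MeasurableSpace X] [Group Γ] [MulAction Γ X] {μ : Measure X}

/-- Negligibility-preserving actions preserve null sets. -/
theorem measure_smul_null_of_negligibilityPreserving
    (hneg : ∀ (g : Γ) (A : Set X), 0 < μ A → 0 < μ (g • A)) (g : Γ) {A : Set X}
    (hA : μ A = 0) : μ (g • A) = 0 := by
  by_contra h
  have := hneg g⁻¹ _ (pos_iff_ne_zero.mpr h)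
  rw [inv_smul_smul] at this
  exact this.ne' hA

theorem smul_ae_eq_of_negligibilityPreserving
    (hneg : ∀ (g : Γ) (A : Set X), 0 < μ A → 0 < μ (g • A)) (g : Γ) {A B : Set X}
    (h : A =ᵐ[μ] B) : (g • A : Set X) =ᵐ[μ] (g • B : Set X) := by
  rw [← measure_symmDiff_eq_zero_iff] at h ⊢
  rw [← Set.smul_set_symmDiff]
  exact measure_smul_null_of_negligibilityPreserving hneg g h

/-- For pairwise almost disjoint translates of `K`, the unions over `A` and `B` are almost disjoint
iff `A` and `B` are disjoint. -/
theorem measure_smul_inter_smul_eq_zero_iff [Countable Γ] {K : Set X}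
    (hK : ∀ g : Γ, μ (g • K) ≠ 0)
    (hdisj : ∀ g h : Γ, g ≠ h → μ ((g • K) ∩ (h • K)) = 0) {A B : Set Γ} :
    μ ((A • K) ∩ (B • K)) = 0 ↔ Disjoint A B := by
  refine ⟨fun h => Set.disjoint_left.mpr fun x hA hB => hK x ?_, fun h => ?_⟩
  · exact measure_mono_null
      (Set.subset_inter (Set.smul_set_subset_smul hA) (Set.smul_set_subset_smul hB)) h
  · rw [← Set.iUnion_smul_set A, ← Set.iUnion_smul_set B, Set.iUnion₂_inter]
    simp only [Set.inter_iUnion₂]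
    refine (measure_biUnion_null_iff A.to_countable).mpr fun a ha =>
      (measure_biUnion_null_iff B.to_countable).mpr fun b hb => hdisj a b ?_
    exact h.ne_of_mem ha hb

theorem subset_of_smul_ae_eq_smul [Countable Γ] {K : Set X} (hK : ∀ g : Γ, μ (g • K) ≠ 0)
    (hdisj : ∀ g h : Γ, g ≠ h → μ ((g • K) ∩ (h • K)) = 0) {A B : Set Γ}
    (h : (A • K : Set X) =ᵐ[μ] (B • K : Set X)) : A ⊆ B := by
  intro x hx
  by_contra hxB
  have hnull := (measure_smul_inter_smul_eq_zero_iff hK hdisj).mpr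
    (Set.disjoint_singleton_left.mpr hxB)
  rw [← measure_congr ((ae_eq_refl _).inter h), Set.singleton_smul,
    Set.inter_eq_left.mpr (Set.smul_set_subset_smul hx)] at hnull
  exact hK x hnull

/-- The translates of `K` over `A` cover the space almost everywhere iff `A` is everything. -/
theorem measure_compl_smul_eq_zero_iff [Countable Γ] {K : Set X} (hK : ∀ g : Γ, μ (g • K) ≠ 0)
    (hdisj : ∀ g h : Γ, g ≠ h → μ ((g • K) ∩ (h • K)) = 0)
    (hcov : μ (((Set.univ : Set Γ) • K)ᶜ) = 0) {A : Set Γ} :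
    μ ((A • K)ᶜ) = 0 ↔ A = Set.univ := by
  refine ⟨fun h => Set.univ_subset_iff.mp (subset_of_smul_ae_eq_smul hK hdisj ?_), ?_⟩
  · exact (ae_eq_univ.mpr hcov).trans (ae_eq_univ.mpr h).symm
  · rintro rfl
    exact hcov

end Grid

theorem statement_1
    (hcont : ∀ g : G, Continuous fun x : W => g • x)
    (μ : Measure W) (hμ : μ ≠ 0) [Countable G]
    (hneg : ∀ (g : G) (A : Set W), 0 < μ A → 0 < μ (g • A))
    (K : Set W) (hKmeas : MeasurableSet K) (hKpos : 0 < μ K)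
    (hgrid : IsCotilerOne μ K (Set.univ : Set G)) :
    -- `T ↦ grp_K(T)` is a well-defined bijection from `≡_λ`-classes of
    -- (positive measure) poly-`K` tiles onto nonempty finite subsets of `G`:
    ((∀ (T : Set W) (D D' : Set G),
        IsPolyKDecomp μ K T D → IsPolyKDecomp μ K T D' → D = D') ∧
      (∀ (T T' : Set W) (D : Set G),
        IsPolyKDecomp μ K T D → IsPolyKDecomp μ K T' D → μ (symmDiff T T') = 0) ∧
      (∀ (T : Set W) (D : Set G), 0 < μ T → IsPolyKDecomp μ K T D → D.Nonempty) ∧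
      (∀ D : Set G, D.Finite → D.Nonempty →
        ∃ T : Set W, 0 < μ T ∧ IsPolyKDecomp μ K T D)) ∧
    -- cotiler correspondence: `C ⊆ G` is a cotiler of a poly-`K` tile `T` in `W` iff
    -- `C` is a cotiler of the finite set `grp_K(T)` in `G` with counting measure,
    -- i.e. `G = ⊔_{g ∈ C} g • grp_K(T)`:
    (∀ (T : Set W) (D : Set G), IsPolyKDecomp μ K T D →
      ∀ C : Set G,
        (IsCotilerOne μ T C ↔
          ((∀ g ∈ C, ∀ h ∈ C, g ≠ h → Disjoint (g • D) (h • D)) ∧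
            (⋃ g ∈ C, g • D) = Set.univ))) := by
  simp only [IsCotilerOne, IsPolyKDecomp, Set.mem_univ, true_implies,
    measure_symmDiff_eq_zero_iff] at hgrid ⊢
  have hK : ∀ g : G, μ (g • K) ≠ 0 := fun g => (hneg g K hKpos).ne'
  obtain ⟨-, hdisj, hcov⟩ := hgrid
  replace hcov : μ (((Set.univ : Set G) • K)ᶜ) = 0 := by
    simpa only [← Set.iUnion_smul_set, Set.mem_univ] using hcov
  simp only [Set.iUnion_smul_set]
  refine ⟨⟨?_, ?_, ?_, ?_⟩, ?_⟩
  · rintro T D D' ⟨-, h⟩ ⟨-, h'⟩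
    exact (subset_of_smul_ae_eq_smul hK hdisj (h.symm.trans h')).antisymm
      (subset_of_smul_ae_eq_smul hK hdisj (h'.symm.trans h))
  · rintro T T' D ⟨-, h⟩ ⟨-, h'⟩
    exact h.trans h'.symm
  · rintro T D hT ⟨-, h⟩
    rw [Set.nonempty_iff_ne_empty]
    rintro rfl
    rw [measure_congr h, Set.empty_smul, measure_empty] at hT
    exact hT.false
  · rintro D hD ⟨x, hx⟩
    exact ⟨D • K, (hneg x K hKpos).trans_le (measure_mono (Set.smul_set_subset_smul hx)), hD,
      ae_eq_refl _⟩
  · rintro T D ⟨-, h⟩ C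
    have hg (g : G) : (g • T : Set W) =ᵐ[μ] ((g • D) • K : Set W) := by
      rw [smul_assoc]
      exact smul_ae_eq_of_negligibilityPreserving hneg g h
    have hU : (C • T : Set W) =ᵐ[μ] ((C • D) • K : Set W) := by
      rw [← Set.iUnion_smul_set C T, ← Set.iUnion_smul_set C D, Set.iUnion₂_smul]
      exact Filter.EventuallyEq.countable_bUnion C.to_countable fun g _ => hg g
    have hI (g k : G) : μ ((g • T) ∩ (k • T)) = 0 ↔ Disjoint (g • D) (k • D) := by
      rw [measure_congr ((hg g).inter (hg k)), measure_smul_inter_smul_eq_zero_iff hK hdisj]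
    rw [measure_congr hU.compl, measure_compl_smul_eq_zero_iff hK hdisj hcov]
    simp only [hI, C.to_countable, true_and]
end

section
/- In Γ⁺, the index-2 subgroup of Γ consisting of elements of even word length in {α,β,γ}, generated by R6 := βα and R3 := γβ, the 8-element set S = {1, R6, R6⁻¹, R6⁻², R3, R3², R3R6⁻¹, R3²R6⁻¹} does not tile Γ⁺: there is no set C ⊆ Γ⁺ such that the left translates cS, c ∈ C, partition Γ⁺. -/
open scoped Pointwise

/-- The Coxeter relations of the symmetry group of the Kitegrid:
`α², β², γ², (αβ)⁶, (βγ)³, (αγ)²`. -/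
def kitegridRels : Set (FreeGroup (Fin 3)) :=
  {(FreeGroup.of 0) ^ 2, (FreeGroup.of 1) ^ 2, (FreeGroup.of 2) ^ 2,
   (FreeGroup.of 0 * FreeGroup.of 1) ^ 6, (FreeGroup.of 1 * FreeGroup.of 2) ^ 3,
   (FreeGroup.of 0 * FreeGroup.of 2) ^ 2}

/-- `Γ = ⟨α, β, γ | α², β², γ², (αβ)⁶, (βγ)³, (αγ)²⟩`. -/
abbrev KitegridGroup := PresentedGroup kitegridRels

namespace KitegridGroup

def α : KitegridGroup := PresentedGroup.of 0
def β : KitegridGroup := PresentedGroup.of 1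
def γ : KitegridGroup := PresentedGroup.of 2

/-- `R6 = βα`. -/
def R6 : KitegridGroup := β * α
/-- `R3 = γβ`. -/
def R3 : KitegridGroup := γ * β

/-- `Γ⁺`, the index-2 subgroup of elements of even word length, generated by `R6` and `R3`. -/
def Γplus : Subgroup KitegridGroup := Subgroup.closure {R6, R3}

/-- The 8-element discretization of the Hat in `Γ⁺`. -/
def hatPlus : Set KitegridGroup :=
  {1, R6, R6⁻¹, R6⁻¹ * R6⁻¹, R3, R3 * R3, R3 * R6⁻¹, R3 * R3 * R6⁻¹}

end KitegridGroup

open KitegridGroup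

/-- Rotation by a sixth of a turn on the Eisenstein lattice, in the basis `1, exp (iπ/3)`. -/
def eisensteinRot (v : ℤ × ℤ) : ℤ × ℤ := (-v.2, v.1 + v.2)

/-- Normal forms of rotation words: the triple `(a, b, k)` is the rotation by `k` sixths of a turn
followed by the translation by `(a, b)`. -/
abbrev EisensteinMotion := ℤ × ℤ × ℕ

namespace EisensteinMotion

def comp (p q : EisensteinMotion) : EisensteinMotion :=
  let v := eisensteinRot^[p.2.2] (q.1, q.2.1)
  (p.1 + v.1, p.2.1 + v.2, (p.2.2 + q.2.2) % 6)

/-- The eight elements of the Hat. -/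
def hat : Fin 8 → EisensteinMotion :=
  ![(0, 0, 0), (0, 0, 1), (0, 0, 5), (0, 0, 4), (1, 0, 2), (0, 1, 4), (1, 0, 1), (0, 1, 3)]

/-- The inverses of the eight elements of the Hat. -/
def hatInv : Fin 8 → EisensteinMotion :=
  ![(0, 0, 0), (0, 0, 5), (0, 0, 1), (0, 0, 2), (0, 1, 4), (1, 0, 2), (-1, 1, 5), (0, 1, 3)]

/-- The translates of the Hat by `p` and `q` overlap, at cells with different labels. -/
def Overlap (p q : EisensteinMotion) : Prop :=
  ∃ i j : Fin 8, i ≠ j ∧ comp p (hat i) = comp q (hat j)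

instance (p q : EisensteinMotion) : Decidable (Overlap p q) :=
  inferInstanceAs (Decidable (∃ i j : Fin 8, i ≠ j ∧ comp p (hat i) = comp q (hat j)))

/-- No family of pairwise non-overlapping translates of the Hat containing the Hat itself covers
everything: covering a few cells next to the Hat is already impossible. -/
theorem not_tiling (A : EisensteinMotion → Prop) (base : A (0, 0, 0))
    (cover : ∀ p, ∃ i, A (comp p (hatInv i)))
    (pack : ∀ p q, A p → A q → ¬ Overlap p q) : False := by
  have key (p : EisensteinMotion) (K : List EisensteinMotion) (hK : ∀ q ∈ K, A q) :
      ∃ i, A (comp p (hatInv i)) ∧ ∀ q ∈ K, ¬ Overlap (comp p (hatInv i)) q := by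
    obtain ⟨i, hi⟩ := cover p
    exact ⟨i, hi, fun q hq => pack _ _ hi (hK q hq)⟩
  obtain ⟨i, hi, hfree⟩ := key (0, 0, 2) [(0, 0, 0)] (by simpa using base)
  have hi' : i = 6 ∨ i = 7 := by clear hi; revert i; decide
  rcases hi' with rfl | rfl
  · have h₁ : A (0, -1, 1) := hi
    obtain ⟨i, hi, hfree⟩ := key (1, -1, 1) [(0, 0, 0), (0, -1, 1)] (by simp [base, h₁])
    obtain rfl : i = 1 := by clear hi; revert i; decide
    have h₂ : A (1, -1, 0) := hi
    obtain ⟨i, -, hfree⟩ :=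
      key (1, -1, 2) [(0, 0, 0), (0, -1, 1), (1, -1, 0)] (by simp [base, h₁, h₂])
    revert i; decide
  · have h₁ : A (-1, 0, 5) := hi
    obtain ⟨i, hi, hfree⟩ := key (-1, 1, 3) [(0, 0, 0), (-1, 0, 5)] (by simp [base, h₁])
    obtain rfl : i = 1 := by clear hi; revert i; decide
    have h₂ : A (-1, 1, 2) := hi
    obtain ⟨i, -, hfree⟩ :=
      key (-1, 1, 4) [(0, 0, 0), (-1, 0, 5), (-1, 1, 2)] (by simp [base, h₁, h₂])
    revert i; decide

end EisensteinMotion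

section Realization

variable {G : Type*} [Group G] {x y : G}

/-- The element of `G` with normal form `p`, where `x` is the rotation by a sixth of a turn and
`y * x⁻¹ * x⁻¹` the translation by `(1, 0)`. -/
def motionWord (x y : G) (p : EisensteinMotion) : G :=
  (y * x⁻¹ * x⁻¹) ^ p.1 * (x * y * x⁻¹ * x⁻¹ * x⁻¹) ^ p.2.1 * x ^ p.2.2

theorem mul_self_eq_inv_of_pow_three (hy : y ^ 3 = 1) : y * y = y⁻¹ := by
  rw [eq_inv_iff_mul_eq_one, ← hy, pow_succ, pow_two]

theorem translations_commute (hx : x ^ 6 = 1) (hxy : x * y * x = y⁻¹) (hy : y ^ 3 = 1) :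
    Commute (y * x⁻¹ * x⁻¹) (x * y * x⁻¹ * x⁻¹ * x⁻¹) := by
  have hyy := mul_self_eq_inv_of_pow_three hy
  have hxy' : x * y = y⁻¹ * x⁻¹ := eq_mul_inv_of_mul_eq hxy
  have hx4 : x⁻¹ * x⁻¹ * x⁻¹ * x⁻¹ = x * x := by
    calc
      x⁻¹ * x⁻¹ * x⁻¹ * x⁻¹ = (x ^ 6)⁻¹ * (x * x) := by group
      _ = x * x := by rw [hx, inv_one, one_mul]
  have hbraid : y * x⁻¹ * y = y⁻¹ * x * y⁻¹ := by
    calc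
      y * x⁻¹ * y = y⁻¹ * (y * y * x⁻¹) * y := by group
      _ = y⁻¹ * (x * y) * y := by rw [hyy, ← hxy']
      _ = y⁻¹ * x * (y * y) := by simp only [mul_assoc]
      _ = y⁻¹ * x * y⁻¹ := by rw [hyy]
  calc
    y * x⁻¹ * x⁻¹ * (x * y * x⁻¹ * x⁻¹ * x⁻¹) = y * x⁻¹ * y * x⁻¹ * x⁻¹ * x⁻¹ := by group
    _ = y⁻¹ * x * (y⁻¹ * x⁻¹) * x⁻¹ * x⁻¹ := by rw [hbraid]; simp only [mul_assoc]
    _ = y⁻¹ * (x * x) * y * x⁻¹ * x⁻¹ := by rw [← hxy']; simp only [mul_assoc]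
    _ = y⁻¹ * x⁻¹ * x⁻¹ * x⁻¹ * x⁻¹ * y * x⁻¹ * x⁻¹ := by rw [← hx4]; simp only [mul_assoc]
    _ = x * y * x⁻¹ * x⁻¹ * x⁻¹ * (y * x⁻¹ * x⁻¹) := by rw [← hxy']; simp only [mul_assoc]

theorem rotation_conj_translation (hxy : x * y * x = y⁻¹) (hy : y ^ 3 = 1) :
    x * (x * y * x⁻¹ * x⁻¹ * x⁻¹) * x⁻¹ =
      (y * x⁻¹ * x⁻¹)⁻¹ * (x * y * x⁻¹ * x⁻¹ * x⁻¹) := by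
  have hyy := mul_self_eq_inv_of_pow_three hy
  have hxy' : x * y = y⁻¹ * x⁻¹ := eq_mul_inv_of_mul_eq hxy
  calc
    x * (x * y * x⁻¹ * x⁻¹ * x⁻¹) * x⁻¹ =
        x * x * y⁻¹ * (y * y) * x⁻¹ * x⁻¹ * x⁻¹ * x⁻¹ := by group
    _ = x * x * y⁻¹ * (y⁻¹ * x⁻¹) * x⁻¹ * x⁻¹ * x⁻¹ := by rw [hyy]; simp only [mul_assoc]
    _ = (y * x⁻¹ * x⁻¹)⁻¹ * (x * y * x⁻¹ * x⁻¹ * x⁻¹) := by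
      rw [← hxy']; simp only [mul_assoc, mul_inv_rev, inv_inv]

theorem rotation_mul_translation (hx : x ^ 6 = 1) (hxy : x * y * x = y⁻¹)
    (hy : y ^ 3 = 1) (v : ℤ × ℤ) :
    x * ((y * x⁻¹ * x⁻¹) ^ v.1 * (x * y * x⁻¹ * x⁻¹ * x⁻¹) ^ v.2) =
      (y * x⁻¹ * x⁻¹) ^ (eisensteinRot v).1 *
        (x * y * x⁻¹ * x⁻¹ * x⁻¹) ^ (eisensteinRot v).2 * x := by
  have hc := translations_commute hx hxy hy
  have hu := rotation_conj_translation hxy hy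
  have ht : x * (y * x⁻¹ * x⁻¹) * x⁻¹ = x * y * x⁻¹ * x⁻¹ * x⁻¹ := by group
  generalize y * x⁻¹ * x⁻¹ = t at *
  generalize x * y * x⁻¹ * x⁻¹ * x⁻¹ = u at *
  rw [← mul_inv_eq_iff_eq_mul, ← MulAut.conj_apply, map_mul, map_zpow, map_zpow,
    MulAut.conj_apply, MulAut.conj_apply, ht, hu, hc.inv_left.mul_zpow, inv_zpow', ← mul_assoc,
    ((hc.symm.zpow_zpow v.1 (-v.2)).eq), mul_assoc, ← zpow_add]
  rfl

theorem rotation_pow_mul_translation (hx : x ^ 6 = 1) (hxy : x * y * x = y⁻¹)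
    (hy : y ^ 3 = 1) (k : ℕ) (v : ℤ × ℤ) :
    x ^ k * ((y * x⁻¹ * x⁻¹) ^ v.1 * (x * y * x⁻¹ * x⁻¹ * x⁻¹) ^ v.2) =
      (y * x⁻¹ * x⁻¹) ^ (eisensteinRot^[k] v).1 *
        (x * y * x⁻¹ * x⁻¹ * x⁻¹) ^ (eisensteinRot^[k] v).2 * x ^ k := by
  induction k generalizing v with
  | zero => simp
  | succ k ih =>
    rw [pow_succ, mul_assoc, rotation_mul_translation hx hxy hy, ← mul_assoc, ih, mul_assoc,
      Function.iterate_succ_apply]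

theorem motionWord_comp (hx : x ^ 6 = 1) (hxy : x * y * x = y⁻¹) (hy : y ^ 3 = 1)
    (p q : EisensteinMotion) :
    motionWord x y (p.comp q) = motionWord x y p * motionWord x y q := by
  obtain ⟨a, b, k⟩ := p
  obtain ⟨c, d, l⟩ := q
  have hc := translations_commute hx hxy hy
  have hrot := rotation_pow_mul_translation hx hxy hy k (c, d)
  simp only [motionWord, EisensteinMotion.comp] at *
  generalize y * x⁻¹ * x⁻¹ = t at *
  generalize x * y * x⁻¹ * x⁻¹ * x⁻¹ = u at *
  rw [← pow_eq_pow_mod _ hx, zpow_add, zpow_add, pow_add]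
  calc
    _ = t ^ a * (t ^ (eisensteinRot^[k] (c, d)).1 * u ^ b) * u ^ (eisensteinRot^[k] (c, d)).2
        * x ^ k * x ^ l := by simp only [mul_assoc]
    _ = t ^ a * u ^ b * (t ^ (eisensteinRot^[k] (c, d)).1 * u ^ (eisensteinRot^[k] (c, d)).2
        * x ^ k) * x ^ l := by
      rw [(hc.zpow_zpow _ _).eq]; simp only [mul_assoc]
    _ = _ := by rw [← hrot]; simp only [mul_assoc]

theorem motionWord_hatInv (hx : x ^ 6 = 1) (hxy : x * y * x = y⁻¹) (hy : y ^ 3 = 1) (i : Fin 8) :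
    motionWord x y (EisensteinMotion.hatInv i) = (motionWord x y (EisensteinMotion.hat i))⁻¹ := by
  have h : (EisensteinMotion.hatInv i).comp (EisensteinMotion.hat i) = (0, 0, 0) := by
    revert i; decide
  rw [eq_inv_iff_mul_eq_one, ← motionWord_comp hx hxy hy, h]
  simp [motionWord]

/-- The Hat spelled out as words in the two rotations. -/
def hatWord (x y : G) : Fin 8 → G :=
  ![1, x, x⁻¹, x⁻¹ * x⁻¹, y, y * y, y * x⁻¹, y * y * x⁻¹]

theorem motionWord_hat (hx : x ^ 6 = 1) (hxy : x * y * x = y⁻¹) (hy : y ^ 3 = 1) (i : Fin 8) :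
    motionWord x y (EisensteinMotion.hat i) = hatWord x y i := by
  have hmul := motionWord_comp hx hxy hy
  have h0 : motionWord x y (0, 0, 0) = 1 := by simp [motionWord]
  have h1 : motionWord x y (0, 0, 1) = x := by simp [motionWord]
  have hy' : motionWord x y (1, 0, 2) = y := by simp [motionWord, pow_two, ← mul_assoc]
  have hinv : motionWord x y (0, 0, 5) = x⁻¹ := by
    rw [eq_inv_iff_mul_eq_one, ← h0]
    nth_rw 2 [← h1]
    exact (hmul _ _).symm
  have h4 := hmul (0, 0, 5) (0, 0, 5)
  have hyy := hmul (1, 0, 2) (1, 0, 2)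
  have hyx := hmul (1, 0, 2) (0, 0, 5)
  have hyyx := hmul (0, 1, 4) (0, 0, 5)
  rw [hinv] at h4 hyx hyyx
  rw [hy'] at hyy hyx
  replace hyy : motionWord x y (0, 1, 4) = y * y := hyy
  rw [hyy] at hyyx
  fin_cases i
  exacts [h0, h1, hinv, h4, hy', hyy, hyx, hyyx]

end Realization

namespace KitegridGroup

theorem relation_eq_one {r : FreeGroup (Fin 3)} (hr : r ∈ kitegridRels) :
    PresentedGroup.mk kitegridRels r = 1 :=
  PresentedGroup.one_of_mem hr

theorem α_inv : α⁻¹ = α := by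
  rw [inv_eq_iff_mul_eq_one, ← pow_two]
  exact relation_eq_one (r := FreeGroup.of 0 ^ 2) (by simp [kitegridRels])

theorem β_inv : β⁻¹ = β := by
  rw [inv_eq_iff_mul_eq_one, ← pow_two]
  exact relation_eq_one (r := FreeGroup.of 1 ^ 2) (by simp [kitegridRels])

theorem γ_inv : γ⁻¹ = γ := by
  rw [inv_eq_iff_mul_eq_one, ← pow_two]
  exact relation_eq_one (r := FreeGroup.of 2 ^ 2) (by simp [kitegridRels])

theorem R6_pow_six : R6 ^ 6 = 1 := by
  rw [R6, show (β * α) ^ 6 = ((α * β) ^ 6)⁻¹ by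
    simp only [pow_succ, pow_zero, one_mul, mul_inv_rev, α_inv, β_inv, mul_assoc]]
  exact inv_eq_one.mpr (relation_eq_one (r := (FreeGroup.of 0 * FreeGroup.of 1) ^ 6)
    (by simp [kitegridRels]))

theorem R3_pow_three : R3 ^ 3 = 1 := by
  rw [R3, show (γ * β) ^ 3 = ((β * γ) ^ 3)⁻¹ by
    simp only [pow_succ, pow_zero, one_mul, mul_inv_rev, β_inv, γ_inv, mul_assoc]]
  exact inv_eq_one.mpr (relation_eq_one (r := (FreeGroup.of 1 * FreeGroup.of 2) ^ 3)
    (by simp [kitegridRels]))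

theorem R6_mul_R3_mul_R6 : R6 * R3 * R6 = R3⁻¹ := by
  have h : (α * γ) ^ 2 = 1 := relation_eq_one
    (r := (FreeGroup.of 0 * FreeGroup.of 2) ^ 2) (by simp [kitegridRels])
  have hcomm : α * γ * α = γ := by
    rw [pow_two, ← mul_assoc, mul_eq_one_iff_eq_inv, γ_inv] at h
    exact h
  calc
    R6 * R3 * R6 = β * (α * γ * (β * β) * α) := by simp only [R6, R3, mul_assoc]
    _ = β * (α * γ * α) := by rw [mul_eq_one_iff_eq_inv.mpr β_inv.symm, mul_one]
    _ = R3⁻¹ := by rw [hcomm, R3, mul_inv_rev, β_inv, γ_inv]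

/-- A permutation representation of the Kitegrid group on six points, separating the Hat. -/
def genPerm : Fin 3 → Equiv.Perm (Fin 6) :=
  ![Equiv.swap 4 5, Equiv.swap 1 2 * Equiv.swap 3 4, Equiv.swap 0 1 * Equiv.swap 4 5]

theorem genPerm_rels : ∀ r ∈ kitegridRels, FreeGroup.lift genPerm r = 1 := by
  simp only [kitegridRels, Set.mem_insert_iff, Set.mem_singleton_iff, forall_eq_or_imp, forall_eq,
    map_pow, map_mul, FreeGroup.lift_apply_of]
  decide

theorem hatWord_injective : Function.Injective (hatWord R6 R3) := by
  let f : KitegridGroup →* Equiv.Perm (Fin 6) := PresentedGroup.toGroup genPerm_rels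
  have h6 : f R6 = genPerm 1 * genPerm 0 := by simp [f, R6, α, β]
  have h3 : f R3 = genPerm 2 * genPerm 1 := by simp [f, R3, γ, β]
  have hf (i : Fin 8) :
      f (hatWord R6 R3 i) = hatWord (genPerm 1 * genPerm 0) (genPerm 2 * genPerm 1) i := by
    rw [← h6, ← h3]
    fin_cases i <;> simp [hatWord]
  have hinj : Function.Injective
      (hatWord (genPerm 1 * genPerm 0) (genPerm 2 * genPerm 1)) := by
    decide
  intro i j hij
  exact hinj (by rw [← hf, ← hf, hij])

theorem range_hatWord : Set.range (hatWord R6 R3) = hatPlus := by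
  ext g
  simp only [hatWord, hatPlus, Matrix.range_cons, Matrix.range_empty, Set.mem_union,
    Set.mem_singleton_iff, Set.mem_insert_iff, Set.mem_empty_iff_false, or_false]

theorem motionWord_mem (p : EisensteinMotion) : motionWord R6 R3 p ∈ Γplus := by
  have h6 : R6 ∈ Γplus := Subgroup.subset_closure (by simp)
  have h3 : R3 ∈ Γplus := Subgroup.subset_closure (by simp)
  have h6' := inv_mem h6
  exact mul_mem (mul_mem (zpow_mem (mul_mem (mul_mem h3 h6') h6') _)
    (zpow_mem (mul_mem (mul_mem (mul_mem (mul_mem h6 h3) h6') h6') h6') _)) (pow_mem h6 _)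

end KitegridGroup

theorem statement_5 :
    -- no family of left translates of `hatPlus` by elements of `Γ⁺` partitions `Γ⁺`:
    ¬ ∃ C : Set KitegridGroup, C ⊆ (Γplus : Set KitegridGroup) ∧
      (∀ c ∈ C, ∀ c' ∈ C, c ≠ c' → Disjoint (c • hatPlus) (c' • hatPlus)) ∧
      (⋃ c ∈ C, c • hatPlus) = (Γplus : Set KitegridGroup) := by
  rintro ⟨C, hC, hdisj, hcover⟩
  have hword := motionWord_comp R6_pow_six R6_mul_R3_mul_R6 R3_pow_three
  have hhat := motionWord_hat R6_pow_six R6_mul_R3_mul_R6 R3_pow_three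
  have hcov (g : KitegridGroup) (hg : g ∈ Γplus) : ∃ i, g * (hatWord R6 R3 i)⁻¹ ∈ C := by
    rw [← SetLike.mem_coe, ← hcover, ← range_hatWord] at hg
    simp only [Set.mem_iUnion, Set.mem_smul_set, Set.mem_range, smul_eq_mul] at hg
    obtain ⟨c, hc, _, ⟨i, rfl⟩, rfl⟩ := hg
    exact ⟨i, by simpa using hc⟩
  obtain ⟨i₀, hi₀⟩ := hcov 1 (one_mem _)
  generalize 1 * (hatWord R6 R3 i₀)⁻¹ = c₀ at hi₀
  refine EisensteinMotion.not_tiling (fun p => c₀ * motionWord R6 R3 p ∈ C)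
    (by simpa [motionWord] using hi₀) (fun p => ?_) ?_
  · obtain ⟨i, hi⟩ := hcov (c₀ * motionWord R6 R3 p) (mul_mem (hC hi₀) (motionWord_mem p))
    refine ⟨i, ?_⟩
    rwa [hword, motionWord_hatInv R6_pow_six R6_mul_R3_mul_R6 R3_pow_three, hhat, ← mul_assoc]
  · rintro p q hp hq ⟨i, j, hij, heq⟩
    have heq' : c₀ * motionWord R6 R3 p * hatWord R6 R3 i =
        c₀ * motionWord R6 R3 q * hatWord R6 R3 j := by
      rw [mul_assoc, mul_assoc, ← hhat, ← hhat, ← hword, ← hword, heq]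
    by_cases hpq : c₀ * motionWord R6 R3 p = c₀ * motionWord R6 R3 q
    · rw [hpq] at heq'
      exact hij (hatWord_injective (mul_left_cancel heq'))
    · have hmem (c : KitegridGroup) (k : Fin 8) : c * hatWord R6 R3 k ∈ c • hatPlus :=
        Set.smul_mem_smul_set (range_hatWord ▸ Set.mem_range_self k)
      exact Set.disjoint_left.mp (hdisj _ hp _ hq hpq) (hmem _ i) (heq' ▸ hmem _ j)
end

section
/- Let T ⊆ W be relatively compact. (i) If the action of G on W is properly discontinuous, then grp(T) is finite for every base point 0 ∈ W. (ii) If G is countable, the action is negligibility-preserving and λ-properly discontinuous, then grp(T) is finite for λ-almost every base point 0 ∈ W. -/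
open scoped Pointwise
open MeasureTheory

theorem statement_10 {W : Type*} [TopologicalSpace W] [MeasurableSpace W] [BorelSpace W]
    {G : Type*} [Group G] [MulAction G W]
    (hcont : ∀ g : G, Continuous fun x : W => g • x)
    (μ : Measure W) (hμ : μ ≠ 0)
    (hneg : ∀ (g : G) (A : Set W), 0 < μ A → 0 < μ (g • A))
    -- `T` is relatively compact:
    (T : Set W) (hT : IsCompact (closure T)) :
    -- (i) if the action is properly discontinuous, `grp(T)` is finite for every base point:
    ((∀ Q : Set W, IsCompact Q → {g : G | ((g • Q) ∩ Q).Nonempty}.Finite) →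
      ∀ w0 : W, {g : G | g • w0 ∈ T}.Finite) ∧
    -- (ii) if `G` is countable and the action is `λ`-properly discontinuous, `grp(T)`
    -- is finite for `μ`-almost every base point:
    (Countable G →
      (∀ Q : Set W, IsCompact Q → {g : G | 0 < μ ((g • Q) ∩ Q)}.Finite) →
      ∀ᵐ w0 ∂μ, {g : G | g • w0 ∈ T}.Finite) := by
  refine ⟨fun h w0 => ?_, fun _ h => ?_⟩
  · refine (h (closure T ∪ {w0}) (hT.union isCompact_singleton)).subset fun g hg => ?_
    exact ⟨g • w0, Set.smul_mem_smul_set (Or.inr rfl), Or.inl (subset_closure hg)⟩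
  · set K := closure T
    set B : Set W := ⋃ g ∈ {g : G | ¬ 0 < μ ((g • K) ∩ K)}, (g • K) ∩ K
    have hB0 : μ B = 0 :=
      (measure_biUnion_null_iff (Set.to_countable _)).2 fun g hg => nonpos_iff_eq_zero.1 (not_lt.1 hg)
    have hsmul (g : G) : μ (g • B) = 0 := by
      by_contra hne
      have hpos := hneg g⁻¹ _ (pos_iff_ne_zero.2 hne)
      rw [inv_smul_smul, hB0] at hpos
      exact hpos.ne rfl
    refine measure_mono_null (fun w0 hw => ?_) (measure_iUnion_null hsmul)
    have hinf : {g : G | g • w0 ∈ T}.Infinite := hw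
    obtain ⟨a, ha⟩ := hinf.nonempty
    -- Translating by `a`, the elements `a * g⁻¹` all satisfy `a • w0 ∈ (a * g⁻¹) • K ∩ K`.
    have hinj : Set.InjOn (fun g : G => a * g⁻¹) {g : G | g • w0 ∈ T} :=
      fun x _ y _ hxy => inv_injective (mul_left_cancel hxy)
    obtain ⟨_, ⟨g, hg, rfl⟩, hnot⟩ := (hinf.image hinj).exists_notMem_finite (h K hT)
    refine Set.mem_iUnion.2 ⟨a⁻¹, Set.mem_inv_smul_set_iff.2 ?_⟩
    refine Set.mem_biUnion hnot ⟨⟨g • w0, subset_closure hg, ?_⟩, subset_closure ha⟩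
    simp [mul_smul]
end

section
/- Let G be a countable group acting on (W, λ) by negligibility-preserving homeomorphisms, and let 𝒯 be a set of tiles. If C ⊆ G×𝒯 is a cotiler of 𝒯 in W, then for λ-almost every base point 0 ∈ W, the family {g·grp(T) : (g,T) ∈ C} is a genuine partition of G; that is, {(g, grp(T)) : (g,T) ∈ C} is a cotiler of {grp(T) : T ∈ 𝒯} in the group G equipped with the counting measure. -/
open scoped Pointwise
open MeasureTheory

theorem ae_forall_smul_notMem {W G : Type*} [MeasurableSpace W] [Group G] [Countable G]
    [MulAction G W] {μ : Measure W}
    (hneg : ∀ (g : G) (A : Set W), 0 < μ A → 0 < μ (g • A)) {N : Set W} (hN : μ N = 0) :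
    ∀ᵐ w ∂μ, ∀ g : G, g • w ∉ N := by
  refine ae_all_iff.2 fun g => ?_
  have hnull : μ (g⁻¹ • N) = 0 := by
    by_contra h
    have hpos := hneg g _ (pos_iff_ne_zero.2 h)
    rw [smul_inv_smul, hN] at hpos
    exact lt_irrefl _ hpos
  filter_upwards [measure_eq_zero_iff_ae_notMem.1 hnull] with w hw
  rwa [Set.mem_inv_smul_set_iff] at hw

theorem mem_smul_setOf_smul_mem_iff {W G : Type*} [Group G] [MulAction G W]
    {g h : G} {T : Set W} {w : W} :
    h ∈ g • {k : G | k • w ∈ T} ↔ h • w ∈ g • T := by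
  simp only [Set.mem_smul_set_iff_inv_smul_mem, Set.mem_ofPred_eq, smul_assoc]

theorem statement_11 {W : Type*} [TopologicalSpace W] [MeasurableSpace W] [BorelSpace W]
    {G : Type*} [Group G] [Countable G] [MulAction G W]
    (hcont : ∀ g : G, Continuous fun x : W => g • x)
    (μ : Measure W) (hμ : μ ≠ 0)
    (hneg : ∀ (g : G) (A : Set W), 0 < μ A → 0 < μ (g • A))
    (𝒯 : Set (Set W)) (h𝒯 : ∀ T ∈ 𝒯, MeasurableSet T ∧ 0 < μ T)
    -- `C` is a cotiler of `𝒯` in `W`: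
    (C : Set (G × Set W)) (hC𝒯 : C ⊆ (Set.univ : Set G) ×ˢ 𝒯) (hCcount : C.Countable)
    (hdisj : ∀ p ∈ C, ∀ q ∈ C, p ≠ q → μ (p.1 • p.2 ∩ q.1 • q.2) = 0)
    (hcover : μ ((⋃ p ∈ C, p.1 • p.2)ᶜ) = 0) :
    -- for a.e. base point, `{g • grp(T) : (g,T) ∈ C}` is a genuine partition of `G`:
    ∀ᵐ w0 ∂μ,
      (∀ p ∈ C, ∀ q ∈ C, p ≠ q →
        Disjoint (p.1 • {g : G | g • w0 ∈ p.2}) (q.1 • {g : G | g • w0 ∈ q.2})) ∧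
      (⋃ p ∈ C, p.1 • {g : G | g • w0 ∈ p.2}) = Set.univ := by
  have hpairs : ∀ᵐ w ∂μ, ∀ p ∈ C, ∀ q ∈ C, p ≠ q → ∀ g : G,
      g • w ∉ p.1 • p.2 ∩ q.1 • q.2 :=
    (ae_ball_iff hCcount).2 fun p hp => (ae_ball_iff hCcount).2 fun q hq =>
      ae_all_iff.2 fun hpq => ae_forall_smul_notMem hneg (hdisj p hp q hq hpq)
  filter_upwards [hpairs, ae_forall_smul_notMem hneg hcover] with w hw hwcover
  refine ⟨fun p hp q hq hpq => Set.disjoint_left.2 fun g hgp hgq => ?_,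
    Set.eq_univ_of_forall fun g => ?_⟩
  · exact hw p hp q hq hpq g
      ⟨mem_smul_setOf_smul_mem_iff.1 hgp, mem_smul_setOf_smul_mem_iff.1 hgq⟩
  · obtain ⟨p, hp, hgp⟩ := Set.mem_iUnion₂.1 (Set.notMem_compl_iff.1 (hwcover g))
    exact Set.mem_iUnion₂.2 ⟨p, hp, mem_smul_setOf_smul_mem_iff.2 hgp⟩
end

section
/- In the cell decomposition setting, the following hold: (i) every K ∈ 𝒦 has the form K = {y ∈ F : χ(y) = S} for some finite (possibly empty) subset S ⊆ G×𝒯; (ii) 𝒦 is a finite set; (iii) the members of 𝒦 are pairwise disjoint and ⊔_{K ∈ 𝒦} K = F up to a λ-null set. -/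
open scoped Pointwise
open MeasureTheory

/-- `χ(x)`: the set of pairs `(g,T)` with `T ∈ 𝒯` such that `g • T` covers `x`. -/
def chiFn {W : Type*} (G : Type*) [Group G] [MulAction G W]
    (𝒯 : Set (Set W)) (x : W) : Set (G × Set W) :=
  {p : G × Set W | p.2 ∈ 𝒯 ∧ x ∈ p.1 • p.2}

/-- The cell `K_x = {y ∈ F : χ(y) = χ(x)}` of a point `x`. -/
def cellOf {W : Type*} (G : Type*) [Group G] [MulAction G W]
    (𝒯 : Set (Set W)) (F : Set W) (x : W) : Set W :=
  {y ∈ F | chiFn G 𝒯 y = chiFn G 𝒯 x}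

/-- The set `𝒦` of positive-measure cells. -/
def cells {W : Type*} [MeasurableSpace W] (G : Type*) [Group G] [MulAction G W]
    (μ : Measure W) (𝒯 : Set (Set W)) (F : Set W) : Set (Set W) :=
  {S : Set W | ∃ x ∈ F, S = cellOf G 𝒯 F x ∧ 0 < μ S}

theorem cellOf_subset_smul_inter {W G : Type*} [Group G] [MulAction G W]
    {𝒯 : Set (Set W)} {F Q : Set W} (hF : F ⊆ Q) (h𝒯 : ∀ T ∈ 𝒯, T ⊆ Q) {x : W}
    {p : G × Set W} (hp : p ∈ chiFn G 𝒯 x) : cellOf G 𝒯 F x ⊆ (p.1 • Q) ∩ Q := by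
  rintro y ⟨hyF, hy⟩
  rw [← hy] at hp
  exact ⟨Set.smul_set_mono (h𝒯 _ hp.1) hp.2, hF hyF⟩

theorem cellOf_subset {W G : Type*} [Group G] [MulAction G W]
    (𝒯 : Set (Set W)) (F : Set W) (x : W) : cellOf G 𝒯 F x ⊆ F := fun _ hy => hy.1

theorem mem_cellOf_self {W G : Type*} [Group G] [MulAction G W]
    {𝒯 : Set (Set W)} {F : Set W} {x : W} (hx : x ∈ F) : x ∈ cellOf G 𝒯 F x := ⟨hx, rfl⟩

theorem chiFn_subset_of_pos {W G : Type*} [MeasurableSpace W] [Group G] [MulAction G W]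
    {μ : Measure W} {𝒯 : Set (Set W)} {F Q : Set W} (hF : F ⊆ Q) (h𝒯 : ∀ T ∈ 𝒯, T ⊆ Q) {x : W}
    (hx : 0 < μ (cellOf G 𝒯 F x)) :
    chiFn G 𝒯 x ⊆ {g : G | 0 < μ ((g • Q) ∩ Q)} ×ˢ 𝒯 := fun _ hp =>
  ⟨hx.trans_le (measure_mono (cellOf_subset_smul_inter hF h𝒯 hp)), hp.1⟩

theorem disjoint_of_mem_cells {W G : Type*} [MeasurableSpace W] [Group G] [MulAction G W]
    {μ : Measure W} {𝒯 : Set (Set W)} {F K K' : Set W} (hK : K ∈ cells G μ 𝒯 F)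
    (hK' : K' ∈ cells G μ 𝒯 F) (hne : K ≠ K') : Disjoint K K' := by
  obtain ⟨x, -, rfl, -⟩ := hK
  obtain ⟨x', -, rfl, -⟩ := hK'
  refine Set.disjoint_left.2 fun y hy hy' => hne ?_
  simp only [cellOf, ← hy.2, ← hy'.2]

theorem measure_diff_iUnion_cells {W G : Type*} [MeasurableSpace W] [Group G] [Countable G]
    [MulAction G W] {μ : Measure W} {𝒯 : Set (Set W)} {F Q : Set W} (hF : F ⊆ Q)
    (h𝒯 : ∀ T ∈ 𝒯, T ⊆ Q) (hfin : ({g : G | 0 < μ ((g • Q) ∩ Q)} ×ˢ 𝒯).Finite) :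
    μ (F \ ⋃ K ∈ cells G μ 𝒯 F, K) = 0 := by
  set M := {g : G | 0 < μ ((g • Q) ∩ Q)} ×ˢ 𝒯 with hM
  set N := {S ∈ 𝒫 M | μ {y ∈ F | chiFn G 𝒯 y = S} = 0} with hN
  have hNc : N.Countable := (hfin.finite_subsets.subset fun _ hS => hS.1).countable
  have hsmall : μ (⋃ S ∈ N, {y ∈ F | chiFn G 𝒯 y = S}) = 0 :=
    (measure_biUnion_null_iff hNc).2 fun _ hS => hS.2
  have hfar : μ (⋃ g ∈ {g : G | μ ((g • Q) ∩ Q) = 0}, (g • Q) ∩ Q) = 0 :=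
    (measure_biUnion_null_iff (Set.to_countable _)).2 fun _ hg => hg
  refine measure_mono_null ?_ (measure_union_null hfar hsmall)
  rintro x ⟨hxF, hx⟩
  have hnull : μ (cellOf G 𝒯 F x) = 0 := by
    by_contra h
    exact hx (Set.mem_biUnion (x := cellOf G 𝒯 F x) ⟨x, hxF, rfl, pos_iff_ne_zero.2 h⟩
      (mem_cellOf_self hxF))
  by_cases hsub : chiFn G 𝒯 x ⊆ M
  · exact Or.inr (Set.mem_biUnion (x := chiFn G 𝒯 x) ⟨hsub, hnull⟩ ⟨hxF, rfl⟩)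
  · obtain ⟨p, hp, hpM⟩ := Set.not_subset.1 hsub
    refine Or.inl (Set.mem_biUnion (x := p.1) ?_
      (cellOf_subset_smul_inter hF h𝒯 hp (mem_cellOf_self hxF)))
    by_contra h
    exact hpM ⟨pos_iff_ne_zero.2 h, hp.1⟩

theorem statement_12 {W : Type*} [TopologicalSpace W] [MeasurableSpace W] [BorelSpace W]
    {G : Type*} [Group G] [Countable G] [MulAction G W]
    (hcont : ∀ g : G, Continuous fun x : W => g • x)
    (μ : Measure W) (hμ : μ ≠ 0)
    (hneg : ∀ (g : G) (A : Set W), 0 < μ A → 0 < μ (g • A))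
    -- the action is cocompact:
    (hcc : ∃ Q : Set W, IsCompact Q ∧ (⋃ g : G, g • Q) = Set.univ)
    -- the action is `λ`-properly discontinuous:
    (hlpd : ∀ Q : Set W, IsCompact Q → {g : G | 0 < μ ((g • Q) ∩ Q)}.Finite)
    -- `𝒯` is a finite set of relatively compact tiles:
    (𝒯 : Set (Set W)) (h𝒯fin : 𝒯.Finite)
    (h𝒯 : ∀ T ∈ 𝒯, MeasurableSet T ∧ 0 < μ T ∧ IsCompact (closure T))
    -- `F` is a relatively compact fundamental domain up to `μ`-null sets:
    (F : Set W) (hFrc : IsCompact (closure F))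
    (hFdisj : ∀ g h : G, g ≠ h → μ ((g • F) ∩ (h • F)) = 0)
    (hFcover : μ ((⋃ g : G, g • F)ᶜ) = 0) :
    -- (i) every `K ∈ 𝒦` is `{y ∈ F : χ(y) = S}` for some finite `S ⊆ G × 𝒯`:
    (∀ K ∈ cells G μ 𝒯 F, ∃ S : Set (G × Set W), S.Finite ∧
        K = {y ∈ F | chiFn G 𝒯 y = S}) ∧
    -- (ii) `𝒦` is finite:
    (cells G μ 𝒯 F).Finite ∧
    -- (iii) the cells are pairwise disjoint and `⊔_{K ∈ 𝒦} K = F` up to a `μ`-null set: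
    (∀ K ∈ cells G μ 𝒯 F, ∀ K' ∈ cells G μ 𝒯 F, K ≠ K' → Disjoint K K') ∧
    μ (symmDiff F (⋃ K ∈ cells G μ 𝒯 F, K)) = 0 := by
  let Q : Set W := closure F ∪ ⋃ T ∈ 𝒯, closure T
  have hQ : IsCompact Q := hFrc.union (h𝒯fin.isCompact_biUnion fun T hT => (h𝒯 T hT).2.2)
  have hFQ : F ⊆ Q := subset_closure.trans Set.subset_union_left
  have hTQ : ∀ T ∈ 𝒯, T ⊆ Q := fun T hT x hx =>
    Or.inr (Set.mem_biUnion hT (subset_closure hx))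
  have hfin : ({g : G | 0 < μ ((g • Q) ∩ Q)} ×ˢ 𝒯).Finite := (hlpd Q hQ).prod h𝒯fin
  refine ⟨?_, ?_, fun K hK K' hK' => disjoint_of_mem_cells hK hK', ?_⟩
  · rintro K ⟨x, -, rfl, hpos⟩
    exact ⟨chiFn G 𝒯 x, hfin.subset (chiFn_subset_of_pos hFQ hTQ hpos), rfl⟩
  · refine (hfin.finite_subsets.image fun S => {y ∈ F | chiFn G 𝒯 y = S}).subset ?_
    rintro K ⟨x, -, rfl, hpos⟩
    exact ⟨chiFn G 𝒯 x, chiFn_subset_of_pos hFQ hTQ hpos, rfl⟩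
  · have hsub : (⋃ K ∈ cells G μ 𝒯 F, K) ⊆ F := by
      refine Set.iUnion₂_subset ?_
      rintro K ⟨x, -, rfl, -⟩
      exact cellOf_subset 𝒯 F x
    rw [Set.symmDiff_def, Set.sdiff_eq_empty.2 hsub, Set.union_empty]
    exact measure_diff_iUnion_cells hFQ hTQ hfin
end

section
/- Assume G is countable and acts on (W, λ) cocompactly, λ-properly discontinuously and by negligibility-preserving homeomorphisms, admitting a relatively compact fundamental domain up to λ-null sets, and let 𝒯 be a finite set of relatively compact tiles. Then there exists a finite set 𝒦 of relatively compact tiles yielding a grid on W (W = ⊔_{(h,K)∈G×𝒦} h·K up to λ-null sets) such that every T ∈ 𝒯 is poly-𝒦, and such that a countable set C ⊆ G×𝒯 is a cotiler of 𝒯 in W if and only if {(g, grp_𝒦(T)) : (g,T) ∈ C} is a cotiler of {grp_𝒦(T) : T ∈ 𝒯} in G×𝒦 with the counting measure, where G acts on G×𝒦 by g·(h,K) = (gh,K). -/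
open scoped Pointwise
open MeasureTheory

variable {W : Type*} [TopologicalSpace W] [MeasurableSpace W] [BorelSpace W]
variable {G : Type*} [Group G] [MulAction G W]

section Grid

variable {X : Type*} {H : Type*} [Group H] [MulAction H X]

/-- The elements of the grid `H × 𝒦` contained in `T`. -/
def gridPart (H : Type*) [Group H] [MulAction H X] (𝒦 : Set (Set X)) (T : Set X) :
    Set (H × Set X) :=
  {p | p.2 ∈ 𝒦 ∧ p.1 • p.2 ⊆ T}

theorem mem_prodSmul_gridPart {𝒦 : Set (Set X)} {g : H} {T : Set X} {p : H × Set X} :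
    p ∈ prodSmul g (gridPart H 𝒦 T) ↔ p.2 ∈ 𝒦 ∧ p.1 • p.2 ⊆ g • T := by
  constructor
  · rintro ⟨q, ⟨hq, hqT⟩, rfl⟩
    refine ⟨hq, ?_⟩
    rw [mul_smul]
    exact Set.smul_set_mono hqT
  · rintro ⟨hp, hpT⟩
    refine ⟨(g⁻¹ * p.1, p.2), ⟨hp, ?_⟩, by simp⟩
    rw [mul_smul]
    exact Set.smul_set_subset_iff_subset_inv_smul_set.2 (by simpa using hpT)

variable [MeasurableSpace X]

theorem measure_smul_eq_zero {μ : Measure X}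
    (hneg : ∀ (g : H) (A : Set X), 0 < μ A → 0 < μ (g • A)) (g : H) {A : Set X}
    (hA : μ A = 0) : μ (g • A) = 0 := by
  by_contra h
  have := hneg g⁻¹ _ (pos_iff_ne_zero.2 h)
  rw [inv_smul_smul] at this
  exact this.ne' hA

/-- If a countable family of translated sets covers `X` almost everywhere, then a set meeting
each of them in a null set is null. -/
theorem measure_eq_zero_of_forall_inter {μ : Measure X} {D : Set (H × Set X)}
    (hD : D.Countable) (hcov : μ ((⋃ p ∈ D, p.1 • p.2)ᶜ) = 0) {A : Set X}
    (hA : ∀ p ∈ D, μ (p.1 • p.2 ∩ A) = 0) : μ A = 0 := by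
  have h : A ⊆ (⋃ p ∈ D, p.1 • p.2)ᶜ ∪ ⋃ p ∈ D, (p.1 • p.2 ∩ A) := by
    intro w hw
    by_cases hc : w ∈ ⋃ p ∈ D, p.1 • p.2
    · simp only [Set.mem_iUnion] at hc
      obtain ⟨p, hp, hwp⟩ := hc
      exact Or.inr (Set.mem_biUnion hp ⟨hwp, hw⟩)
    · exact Or.inl hc
  exact measure_mono_null h (measure_union_null hcov ((measure_biUnion_null_iff hD).2 hA))

/-- The cells of the partition of `F` according to membership in the translates indexed
by `S`, with the null cells discarded. -/
def gridCells (μ : Measure X) (F : Set X) (S : Set (H × Set X)) : Set (Set X) :=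
  {K | 0 < μ K ∧ ∃ s ⊆ S, K = {w ∈ F | {p ∈ S | w ∈ p.1 • p.2} = s}}

theorem finite_gridCells (μ : Measure X) (F : Set X) {S : Set (H × Set X)} (hS : S.Finite) :
    (gridCells μ F S).Finite := by
  refine (hS.finite_subsets.image fun s => {w ∈ F | {p ∈ S | w ∈ p.1 • p.2} = s}).subset ?_
  rintro K ⟨-, s, hs, rfl⟩
  exact ⟨s, hs, rfl⟩

theorem subset_of_mem_gridCells {μ : Measure X} {F : Set X} {S : Set (H × Set X)} {K : Set X}
    (hK : K ∈ gridCells μ F S) : K ⊆ F := by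
  obtain ⟨-, s, -, rfl⟩ := hK
  exact Set.sep_subset _ _

theorem disjoint_of_mem_gridCells {μ : Measure X} {F : Set X} {S : Set (H × Set X)}
    {K L : Set X} (hK : K ∈ gridCells μ F S) (hL : L ∈ gridCells μ F S) (hKL : K ≠ L) :
    Disjoint K L := by
  obtain ⟨-, s, -, rfl⟩ := hK
  obtain ⟨-, t, -, rfl⟩ := hL
  refine Set.disjoint_left.2 fun w hw hw' => hKL ?_
  rw [← hw.2, ← hw'.2]

theorem subset_smul_of_mem_gridCells {μ : Measure X} {F : Set X} {S : Set (H × Set X)}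
    {K : Set X} (hK : K ∈ gridCells μ F S) {p : H × Set X} (hp : p ∈ S)
    (h : (K ∩ p.1 • p.2).Nonempty) : K ⊆ p.1 • p.2 := by
  obtain ⟨-, s, -, rfl⟩ := hK
  obtain ⟨w, hw, hwp⟩ := h
  intro v hv
  have : p ∈ {p ∈ S | w ∈ p.1 • p.2} := ⟨hp, hwp⟩
  rw [hw.2, ← hv.2] at this
  exact this.2

theorem isCotiler_gridCells [Countable H] {μ : Measure X}
    (hneg : ∀ (g : H) (A : Set X), 0 < μ A → 0 < μ (g • A)) {F : Set X}
    (hdisj : ∀ g h : H, g ≠ h → μ ((g • F) ∩ (h • F)) = 0)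
    (hcov : μ ((⋃ g : H, g • F)ᶜ) = 0) {S : Set (H × Set X)} (hS : S.Finite) :
    IsCotiler μ ((Set.univ : Set H) ×ˢ gridCells μ F S) := by
  refine ⟨Set.countable_univ.prod (finite_gridCells μ F hS).countable, ?_, ?_⟩
  · rintro ⟨g, K⟩ ⟨-, hK⟩ ⟨h, L⟩ ⟨-, hL⟩ hne
    by_cases hgh : g = h
    · subst hgh
      have hKL : K ≠ L := fun h => hne (by rw [h])
      have := disjoint_of_mem_gridCells hK hL hKL
      simp only [← Set.smul_set_inter, this.inter_eq, Set.smul_set_empty, measure_empty]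
    · exact measure_mono_null (Set.inter_subset_inter
        (Set.smul_set_mono (subset_of_mem_gridCells hK))
        (Set.smul_set_mono (subset_of_mem_gridCells hL))) (hdisj g h hgh)
  · let cell : Set (H × Set X) → Set X := fun s => {w ∈ F | {p ∈ S | w ∈ p.1 • p.2} = s}
    let N : Set (Set (H × Set X)) := {s | s ⊆ S ∧ μ (cell s) = 0}
    have hN : N.Countable := (hS.finite_subsets.subset fun s hs => hs.1).countable
    have hnull : μ (⋃ g : H, ⋃ s ∈ N, g • cell s) = 0 :=
      measure_iUnion_null fun g => (measure_biUnion_null_iff hN).2 fun s hs =>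
        measure_smul_eq_zero hneg g hs.2
    refine measure_mono_null ?_ (measure_union_null hcov hnull)
    intro w hw
    by_cases hc : w ∈ ⋃ g : H, g • F
    · obtain ⟨g, v, hv, rfl⟩ := Set.mem_iUnion.1 hc
      have hvc : v ∈ cell {p ∈ S | v ∈ p.1 • p.2} := ⟨hv, rfl⟩
      refine Or.inr (Set.mem_iUnion.2 ⟨g, Set.mem_biUnion (x := {p ∈ S | v ∈ p.1 • p.2})
        ⟨Set.sep_subset _ _, ?_⟩ (Set.smul_mem_smul_set hvc)⟩)
      by_contra h0
      exact hw (Set.mem_biUnion (x := (g, cell {p ∈ S | v ∈ p.1 • p.2}))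
        ⟨Set.mem_univ _, pos_iff_ne_zero.2 h0, _, Set.sep_subset _ _, rfl⟩
        (Set.smul_mem_smul_set hvc))
    · exact Or.inl hc

theorem measure_symmDiff_gridPart_eq_zero {μ : Measure X} {𝒦 : Set (Set X)}
    (hgrid : IsCotiler μ ((Set.univ : Set H) ×ˢ 𝒦)) {T : Set X}
    (hT : ∀ (g : H), ∀ K ∈ 𝒦, μ (g • K ∩ T) ≠ 0 → g • K ⊆ T) :
    μ (symmDiff T (⋃ p ∈ gridPart H 𝒦 T, p.1 • p.2)) = 0 := by
  have hsub : (⋃ p ∈ gridPart H 𝒦 T, p.1 • p.2) ⊆ T := Set.iUnion₂_subset fun p hp => hp.2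
  rw [Set.symmDiff_def, Set.sdiff_eq_empty.2 hsub, Set.union_empty]
  refine measure_eq_zero_of_forall_inter hgrid.1 hgrid.2.2 ?_
  rintro ⟨g, K⟩ ⟨-, hK⟩
  by_contra h0
  have hgK : g • K ⊆ T := hT g K hK fun h =>
    h0 (measure_mono_null (Set.inter_subset_inter_right _ Set.sdiff_subset) h)
  obtain ⟨w, hw, -, hw'⟩ := nonempty_of_measure_ne_zero h0
  exact hw' (Set.mem_biUnion (x := (g, K)) ⟨hK, hgK⟩ hw)

theorem isCotiler_iff_gridPart [Countable H] {μ : Measure X} {𝒦 𝒯 : Set (Set X)}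
    (hneg : ∀ (g : H) (A : Set X), 0 < μ A → 0 < μ (g • A)) (h𝒦 : ∀ K ∈ 𝒦, 0 < μ K)
    (hgrid : IsCotiler μ ((Set.univ : Set H) ×ˢ 𝒦))
    (h𝒯 : ∀ T ∈ 𝒯, ∀ (g : H), ∀ K ∈ 𝒦, μ (g • K ∩ T) ≠ 0 → g • K ⊆ T)
    {C : Set (H × Set X)} (hC : C ⊆ (Set.univ : Set H) ×ˢ 𝒯) :
    IsCotiler μ C ↔
      (C.Countable ∧
        (∀ p ∈ C, ∀ q ∈ C, p ≠ q →
          Disjoint (prodSmul p.1 (gridPart H 𝒦 p.2)) (prodSmul q.1 (gridPart H 𝒦 q.2))) ∧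
        (⋃ p ∈ C, prodSmul p.1 (gridPart H 𝒦 p.2)) = (Set.univ : Set H) ×ˢ 𝒦) := by
  have key : ∀ p ∈ C, ∀ (h : H), ∀ K ∈ 𝒦, μ (h • K ∩ p.1 • p.2) ≠ 0 →
      h • K ⊆ p.1 • p.2 := by
    intro p hp h K hK h0
    have := h𝒯 p.2 (hC hp).2 (p.1⁻¹ * h) K hK fun h1 => h0 <| by
      have := measure_smul_eq_zero hneg p.1 h1
      rwa [Set.smul_set_inter, mul_smul, smul_inv_smul] at this
    rw [mul_smul] at this
    simpa using Set.smul_set_mono (a := p.1) this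
  refine and_congr_right fun hcount => and_congr ?_ ?_
  · refine forall₂_congr fun p hp => forall₂_congr fun q hq => imp_congr_right fun _ => ?_
    constructor
    · refine fun h0 => Set.disjoint_left.2 fun r hr hr' => ?_
      rw [mem_prodSmul_gridPart] at hr hr'
      exact (hneg r.1 _ (h𝒦 _ hr.1)).ne' (measure_mono_null (Set.subset_inter hr.2 hr'.2) h0)
    · intro hd
      refine measure_eq_zero_of_forall_inter hgrid.1 hgrid.2.2 fun r hr => ?_
      by_contra h0
      refine Set.disjoint_left.1 hd
        (mem_prodSmul_gridPart.2 ⟨hr.2, key p hp _ _ hr.2 fun h => h0 (measure_mono_null ?_ h)⟩)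
        (mem_prodSmul_gridPart.2 ⟨hr.2, key q hq _ _ hr.2 fun h => h0 (measure_mono_null ?_ h)⟩)
      · exact Set.inter_subset_inter_right _ Set.inter_subset_left
      · exact Set.inter_subset_inter_right _ Set.inter_subset_right
  · constructor
    · intro hcov
      refine Set.Subset.antisymm (Set.iUnion₂_subset fun p _ r hr =>
        ⟨Set.mem_univ _, (mem_prodSmul_gridPart.1 hr).1⟩) fun r hr => ?_
      by_contra hr'
      refine (hneg r.1 _ (h𝒦 _ hr.2)).ne' (measure_eq_zero_of_forall_inter hcount hcov ?_)
      intro p hp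
      by_contra h0
      rw [Set.inter_comm] at h0
      exact hr' (Set.mem_biUnion hp (mem_prodSmul_gridPart.2 ⟨hr.2, key p hp _ _ hr.2 h0⟩))
    · intro hcov
      refine measure_mono_null (Set.compl_subset_compl.2 (Set.iUnion₂_subset fun r hr => ?_))
        hgrid.2.2
      rw [← hcov] at hr
      simp only [Set.mem_iUnion] at hr
      obtain ⟨p, hp, hrp⟩ := hr
      exact (mem_prodSmul_gridPart.1 hrp).2.trans
        (Set.subset_biUnion_of_mem (u := fun p : H × Set X => p.1 • p.2) hp)

end Grid

theorem statement_14
    [Countable G]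
    (hcont : ∀ g : G, Continuous fun x : W => g • x)
    (μ : Measure W) (hμ : μ ≠ 0)
    (hneg : ∀ (g : G) (A : Set W), 0 < μ A → 0 < μ (g • A))
    -- the action is cocompact:
    (hcc : ∃ Q : Set W, IsCompact Q ∧ (⋃ g : G, g • Q) = Set.univ)
    -- the action is `λ`-properly discontinuous:
    (hlpd : ∀ Q : Set W, IsCompact Q → {g : G | 0 < μ ((g • Q) ∩ Q)}.Finite)
    -- the action admits a relatively compact fundamental domain up to `μ`-null sets:
    (hFD : ∃ F : Set W, IsCompact (closure F) ∧
      (∀ g h : G, g ≠ h → μ ((g • F) ∩ (h • F)) = 0) ∧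
      μ ((⋃ g : G, g • F)ᶜ) = 0)
    -- `𝒯` is a finite set of relatively compact tiles:
    (𝒯 : Set (Set W)) (h𝒯fin : 𝒯.Finite)
    (h𝒯 : ∀ T ∈ 𝒯, MeasurableSet T ∧ 0 < μ T ∧ IsCompact (closure T)) :
    -- there is a finite set `𝒦` of relatively compact tiles yielding a grid,
    -- with a decomposition map `grpK` making every `T ∈ 𝒯` a poly-`𝒦`, and such that
    -- `C` is a cotiler of `𝒯` in `W` iff the renamed family is a cotiler (a genuine
    -- partition) of `{grp_𝒦(T) : T ∈ 𝒯}` in `G × 𝒦` with the counting measure: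
    ∃ (𝒦 : Set (Set W)) (grpK : Set W → Set (G × Set W)),
      𝒦.Finite ∧ (∀ K ∈ 𝒦, 0 < μ K ∧ IsCompact (closure K)) ∧
      IsCotiler μ ((Set.univ : Set G) ×ˢ 𝒦) ∧
      (∀ T ∈ 𝒯, (grpK T).Finite ∧ grpK T ⊆ (Set.univ : Set G) ×ˢ 𝒦 ∧
        μ (symmDiff T (⋃ p ∈ grpK T, p.1 • p.2)) = 0) ∧
      (∀ C : Set (G × Set W), C ⊆ (Set.univ : Set G) ×ˢ 𝒯 →
        (IsCotiler μ C ↔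
          (C.Countable ∧
            (∀ p ∈ C, ∀ q ∈ C, p ≠ q →
              Disjoint (prodSmul p.1 (grpK p.2)) (prodSmul q.1 (grpK q.2))) ∧
            (⋃ p ∈ C, prodSmul p.1 (grpK p.2)) = (Set.univ : Set G) ×ˢ 𝒦))) := by
  obtain ⟨F, hF, hdisj, hcov⟩ := hFD
  let S : Set (G × Set W) := {p | p.2 ∈ 𝒯 ∧ μ (F ∩ p.1 • p.2) ≠ 0}
  have hS : S.Finite := by
    have hfib : ∀ T ∈ 𝒯, {g : G | μ (F ∩ g • T) ≠ 0}.Finite := fun T hT => by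
      refine (hlpd (closure F ∪ closure T) (hF.union (h𝒯 T hT).2.2)).subset fun g hg => ?_
      refine pos_iff_ne_zero.2 fun h0 => hg (measure_mono_null ?_ h0)
      rw [Set.inter_comm]
      exact Set.inter_subset_inter
        (Set.smul_set_mono (subset_closure.trans Set.subset_union_right))
        (subset_closure.trans Set.subset_union_left)
    refine (h𝒯fin.biUnion fun T hT => (hfib T hT).image fun g => (g, T)).subset ?_
    rintro ⟨g, T⟩ ⟨hT, hg⟩
    exact Set.mem_biUnion hT ⟨g, hg, rfl⟩
  have hmem : ∀ T ∈ 𝒯, ∀ (g : G), ∀ K ∈ gridCells μ F S, μ (g • K ∩ T) ≠ 0 →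
      μ (K ∩ g⁻¹ • T) ≠ 0 ∧ (g⁻¹, T) ∈ S := by
    intro T hT g K hK h0
    have h1 : μ (K ∩ g⁻¹ • T) ≠ 0 := fun h => h0 <| by
      simpa [Set.smul_set_inter] using measure_smul_eq_zero hneg g h
    exact ⟨h1, hT, fun h => h1 (measure_mono_null
      (Set.inter_subset_inter_left _ (subset_of_mem_gridCells hK)) h)⟩
  have hdich : ∀ T ∈ 𝒯, ∀ (g : G), ∀ K ∈ gridCells μ F S, μ (g • K ∩ T) ≠ 0 →
      g • K ⊆ T := by
    intro T hT g K hK h0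
    obtain ⟨h1, hp⟩ := hmem T hT g K hK h0
    exact Set.smul_set_subset_iff_subset_inv_smul_set.2
      (subset_smul_of_mem_gridCells hK hp (nonempty_of_measure_ne_zero h1))
  have hgrid := isCotiler_gridCells hneg hdisj hcov hS
  refine ⟨gridCells μ F S, gridPart G (gridCells μ F S), finite_gridCells μ F hS,
    fun K hK => ⟨hK.1, hF.of_isClosed_subset isClosed_closure
      (closure_mono (subset_of_mem_gridCells hK))⟩, hgrid, fun T hT => ⟨?_, fun p hp =>
      ⟨Set.mem_univ _, hp.1⟩, measure_symmDiff_gridPart_eq_zero hgrid (hdich T hT)⟩,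
    fun C hC => isCotiler_iff_gridPart hneg (fun K hK => hK.1) hgrid hdich hC⟩
  refine ((hS.image fun p => p.1⁻¹).prod (finite_gridCells μ F hS)).subset ?_
  rintro ⟨g, K⟩ ⟨hK, hgK⟩
  refine ⟨⟨_, (hmem T hT g K hK ?_).2, inv_inv g⟩, hK⟩
  rw [Set.inter_eq_left.2 hgK]
  exact (hneg g K hK.1).ne'
end
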